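/- (Finite determination with quadratic constraints.) Suppose A^k → 0 as k → ∞ (equivalently, A is Schur stable), Ω is compact with the origin in its interior, Θ = ℝ^n, X = Ω, and Q_1 = (1/D_x) I_n with q_1 = 0 for some D_x > 0. Then there exists a finite k* ∈ ℕ such that for every Q ∈ 𝒬_{k*+1} \ 𝒬_{k*} there exists M ∈ cone(𝒬_{k*}) with Q ⪯ M, and consequently O_k = O_{k*} for all k ≥ k*, so that the maximal constraint-admissible invariant set O_∞ := ∩_{k ∈ ℕ} O_k equals O_{k*}. -/

import Mathlib

open Matrix

/-- The cone (set of nonnegative linear combinations) generated by a set of matrices. -/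
def matCone {α : Type*} [AddCommMonoid α] [Module ℝ α] (S : Set α) : Set α :=
  { M | ∃ (t : Finset α) (c : α → ℝ), (↑t : Set α) ⊆ S ∧ (∀ x ∈ t, 0 ≤ c x) ∧
      M = ∑ x ∈ t, c x • x }

open Filter Topology

theorem Matrix.IsHermitian.posSemidef_of_abs_sub_diagonal_le {m : Type*} [Fintype m]
    [DecidableEq m] {F : Matrix m m ℝ} (hF : F.IsHermitian) (d : m → ℝ)
    (hd : ∀ i j, Fintype.card m * |F i j - diagonal d i j| ≤ min (d i) (d j)) :
    F.PosSemidef := by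
  refine .of_dotProduct_mulVec_nonneg hF fun x => ?_
  rcases isEmpty_or_nonempty m with _ | _
  · simp [dotProduct]
  have hN : (0 : ℝ) < Fintype.card m := by exact_mod_cast Fintype.card_pos
  have hD : x ⬝ᵥ diagonal d *ᵥ x = ∑ i, d i * x i ^ 2 := by
    simp only [dotProduct, mulVec_diagonal]
    exact Finset.sum_congr rfl fun i _ => by ring
  have hE : x ⬝ᵥ (F - diagonal d) *ᵥ x = ∑ i, ∑ j, x i * ((F - diagonal d) i j * x j) := by
    simp [dotProduct, mulVec, Finset.mul_sum]
  have hS : ∑ i, ∑ j, (d i * x i ^ 2 + d j * x j ^ 2) / (2 * Fintype.card m)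
      = ∑ i, d i * x i ^ 2 := by
    simp only [← Finset.sum_div, Finset.sum_add_distrib, Finset.sum_const, Finset.card_univ,
      nsmul_eq_mul, ← Finset.mul_sum]
    field_simp
    ring
  have key : -∑ i, d i * x i ^ 2 ≤ x ⬝ᵥ (F - diagonal d) *ᵥ x := by
    rw [hE, ← hS]
    simp only [← Finset.sum_neg_distrib]
    refine Finset.sum_le_sum fun i _ => Finset.sum_le_sum fun j _ => ?_
    obtain ⟨hi, hj⟩ := le_min_iff.1 (hd i j)
    rw [← Matrix.sub_apply] at hi hj
    set e := (F - diagonal d) i j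
    have h1 : |x i * (e * x j)| ≤ (d i * x i ^ 2 + d j * x j ^ 2) / (2 * Fintype.card m) := by
      rw [le_div_iff₀ (by positivity), abs_mul, abs_mul]
      have h2 : 0 ≤ |e| * Fintype.card m := by positivity
      nlinarith [mul_nonneg h2 (sq_nonneg (|x i| - |x j|)), sq_abs (x i), sq_abs (x j),
        mul_le_mul_of_nonneg_right hi (sq_nonneg (x i)),
        mul_le_mul_of_nonneg_right hj (sq_nonneg (x j))]
    exact neg_le_of_abs_le h1
  rw [star_trivial, ← sub_add_cancel F (diagonal d), add_mulVec, dotProduct_add, hD]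
  linarith

theorem Filter.Tendsto.eventually_posSemidef_of_diagonal {ι m : Type*} [Fintype m] [DecidableEq m]
    {l : Filter ι} {F : ι → Matrix m m ℝ} {d : m → ℝ} (hd : ∀ i, 0 < d i)
    (hF : ∀ᶠ t in l, (F t).IsHermitian) (h : Tendsto F l (𝓝 (diagonal d))) :
    ∀ᶠ t in l, (F t).PosSemidef := by
  have key : ∀ᶠ t in l, ∀ i j,
      Fintype.card m * |F t i j - diagonal d i j| ≤ min (d i) (d j) := by
    refine eventually_all.2 fun i => eventually_all.2 fun j => ?_
    have h1 : Tendsto (fun t => F t i j) l (𝓝 (diagonal d i j)) :=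
      tendsto_pi_nhds.1 (tendsto_pi_nhds.1 h i) j
    have h2 : Tendsto (fun t => Fintype.card m * |F t i j - diagonal d i j|) l (𝓝 0) := by
      simpa using ((h1.sub_const (diagonal d i j)).abs).const_mul (Fintype.card m : ℝ)
    exact h2.eventually_le_const (lt_min (hd i) (hd j))
  filter_upwards [hF, key] with t ht hk
  exact ht.posSemidef_of_abs_sub_diagonal_le d hk

theorem smul_mem_matCone {α : Type*} [AddCommMonoid α] [Module ℝ α] {S : Set α} {x : α}
    (hx : x ∈ S) {c : ℝ} (hc : 0 ≤ c) : c • x ∈ matCone S :=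
  ⟨{x}, fun _ => c, by simpa using hx, fun _ _ => hc, by simp⟩

/-- The quadratic form of a nonnegative combination of matrices whose forms are nonpositive at `v`
is nonpositive at `v`. -/
theorem dotProduct_mulVec_nonpos_of_mem_matCone {m : Type*} [Fintype m] {S : Set (Matrix m m ℝ)}
    {v : m → ℝ} (hS : ∀ M ∈ S, v ⬝ᵥ M *ᵥ v ≤ 0) {M : Matrix m m ℝ} (hM : M ∈ matCone S) :
    v ⬝ᵥ M *ᵥ v ≤ 0 := by
  obtain ⟨t, c, ht, hc, rfl⟩ := hM
  rw [sum_mulVec, dotProduct_sum]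
  refine Finset.sum_nonpos fun x hx => ?_
  rw [smul_mulVec, dotProduct_smul, smul_eq_mul]
  exact mul_nonpos_of_nonneg_of_nonpos (hc x hx) (hS x (ht hx))

theorem dotProduct_transpose_mul_mul_mulVec {m : Type*} [Fintype m] (B M : Matrix m m ℝ)
    (v : m → ℝ) : v ⬝ᵥ (Bᵀ * M * B) *ᵥ v = (B *ᵥ v) ⬝ᵥ M *ᵥ (B *ᵥ v) := by
  rw [← mulVec_mulVec, ← mulVec_mulVec, dotProduct_mulVec, vecMul_transpose]

/-- Finite determination with quadratic constraints: under Schur stability of A,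
compactness of Ω with 0 in its interior, and the redundant ball constraint
Q_1 = (1/D_x)I, q_1 = 0, there is a finite k* such that every matrix of
𝒬_{k*+1} \ 𝒬_{k*} is dominated by an element of cone(𝒬_{k*}); consequently
O_k = O_{k*} for all k ≥ k* and O_∞ := ⋂_k O_k equals O_{k*}. -/
theorem finite_determination_quadratic (n p : ℕ) (hp : 0 < p)
    (A : Matrix (Fin n) (Fin n) ℝ)
    (hA : Filter.Tendsto (fun k : ℕ => A ^ k) Filter.atTop (nhds 0))
    (Q : Fin p → Matrix (Fin n) (Fin n) ℝ) (q : Fin p → Fin n → ℝ)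
    (hQsymm : ∀ i, (Q i)ᵀ = Q i)
    (Ω : Set (Fin n → ℝ))
    (hΩ : Ω = {x : Fin n → ℝ | ∀ i : Fin p, x ⬝ᵥ (Q i).mulVec x + 2 * (q i ⬝ᵥ x) ≤ 1})
    (hΩcompact : IsCompact Ω) (hΩint : (0 : Fin n → ℝ) ∈ interior Ω)
    (Dx : ℝ) (hDx : 0 < Dx)
    (hQ1 : Q ⟨0, hp⟩ = (1 / Dx) • (1 : Matrix (Fin n) (Fin n) ℝ))
    (hq1 : q ⟨0, hp⟩ = 0)
    (X : Set (Fin n → ℝ)) (hX : X = Ω)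
    (O : ℕ → Set (Fin n → ℝ)) (hO0 : O 0 = X)
    (hOsucc : ∀ k : ℕ, O (k + 1) = O k ∩ {x : Fin n → ℝ | A.mulVec x ∈ O k})
    (Abar : Matrix (Fin n ⊕ Unit) (Fin n ⊕ Unit) ℝ)
    (hAbar : Abar = Matrix.fromBlocks A 0 0 1)
    (Qbar : Fin p → Matrix (Fin n ⊕ Unit) (Fin n ⊕ Unit) ℝ)
    (hQbar : ∀ i, Qbar i = Matrix.fromBlocks (Q i) (Matrix.of fun r (_ : Unit) => q i r)
      (Matrix.of fun (_ : Unit) c => q i c) (Matrix.of fun (_ : Unit) (_ : Unit) => (-1 : ℝ)))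
    (𝒬 : ℕ → Set (Matrix (Fin n ⊕ Unit) (Fin n ⊕ Unit) ℝ))
    (h𝒬0 : 𝒬 0 = Set.range Qbar)
    (h𝒬succ : ∀ k : ℕ, 𝒬 (k + 1) = 𝒬 k ∪ (fun M => Abarᵀ * M * Abar) '' 𝒬 k) :
    ∃ kstar : ℕ,
      (∀ Q' ∈ 𝒬 (kstar + 1) \ 𝒬 kstar, ∃ M ∈ matCone (𝒬 kstar), (M - Q').PosSemidef) ∧
      (∀ k : ℕ, kstar ≤ k → O k = O kstar) ∧
      (⋂ k : ℕ, O k) = O kstar := by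
  have hmono : Monotone 𝒬 := monotone_nat_of_le_succ fun k => by
    rw [h𝒬succ]; exact Set.subset_union_left
  have hnew : ∀ k, ∀ Q' ∈ 𝒬 (k + 1) \ 𝒬 k,
      ∃ i, Q' = (Abar ^ (k + 1))ᵀ * Qbar i * Abar ^ (k + 1) := by
    intro k
    induction k with
    | zero =>
      rintro Q' ⟨h1, h2⟩
      rw [h𝒬succ] at h1
      obtain ⟨M, hM, rfl⟩ := h1.resolve_left h2
      rw [h𝒬0] at hM
      obtain ⟨i, rfl⟩ := hM
      exact ⟨i, by simp⟩
    | succ k ih =>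
      rintro Q' ⟨h1, h2⟩
      rw [h𝒬succ] at h1
      obtain ⟨M, hM, rfl⟩ := h1.resolve_left h2
      have hMk : M ∉ 𝒬 k := fun h => h2 (by rw [h𝒬succ]; exact Or.inr ⟨M, h, rfl⟩)
      obtain ⟨i, rfl⟩ := ih M ⟨hM, hMk⟩
      refine ⟨i, ?_⟩
      rw [pow_succ Abar (k + 1), transpose_mul]
      simp only [Matrix.mul_assoc]
  have hQ0 : ∀ k, Qbar ⟨0, hp⟩ ∈ 𝒬 k := fun k =>
    hmono (Nat.zero_le k) (by rw [h𝒬0]; exact ⟨_, rfl⟩)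
  have hsymm : ∀ i, (Qbar i)ᵀ = Qbar i := fun i => by
    rw [hQbar, fromBlocks_transpose, hQsymm]
    rfl
  have hpow : ∀ k, Abar ^ k = fromBlocks (A ^ k) 0 0 1 := fun k => by
    rw [hAbar, fromBlocks_diagonal_pow, one_pow]
  have hlim : Tendsto (fun k => Abar ^ k) atTop (𝓝 (fromBlocks 0 0 0 1)) := by
    simp only [hpow]
    have hc : Continuous fun B : Matrix (Fin n) (Fin n) ℝ =>
        (fromBlocks B 0 0 1 : Matrix (Fin n ⊕ Unit) (Fin n ⊕ Unit) ℝ) :=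
      continuous_id.matrix_fromBlocks continuous_const continuous_const continuous_const
    exact (hc.tendsto 0).comp hA
  have hdom : ∀ᶠ k in atTop, ∀ i,
      ((1 / 2 : ℝ) • Qbar ⟨0, hp⟩ - (Abar ^ k)ᵀ * Qbar i * Abar ^ k).PosSemidef := by
    refine eventually_all.2 fun i => ?_
    have hc : Continuous fun B : Matrix (Fin n ⊕ Unit) (Fin n ⊕ Unit) ℝ =>
        (1 / 2 : ℝ) • Qbar ⟨0, hp⟩ - Bᵀ * Qbar i * B := by fun_prop
    refine Tendsto.eventually_posSemidef_of_diagonal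
      (d := Sum.elim (fun _ => 1 / (2 * Dx)) fun _ => 1 / 2) ?_ (Eventually.of_forall fun k => ?_) ?_
    · rintro (j | j)
      · simpa using hDx
      · simp
    · simp [IsHermitian, conjTranspose_eq_transpose_of_trivial, transpose_mul, hsymm,
        Matrix.mul_assoc]
    · suffices hval : diagonal (Sum.elim (fun _ => 1 / (2 * Dx)) fun _ => 1 / 2) =
          (1 / 2 : ℝ) • Qbar ⟨0, hp⟩ -
            (fromBlocks 0 0 0 1)ᵀ * Qbar i * fromBlocks 0 0 0 1 by
        rw [hval]
        exact (hc.tendsto _).comp hlim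
      rw [hQbar, hQbar, hQ1, hq1, fromBlocks_transpose, fromBlocks_multiply, fromBlocks_multiply]
      ext (a | a) (b | b)
      · by_cases hab : a = b
        · subst hab
          simp
          ring
        · simp [hab]
      · simp
      · simp
      · simp
        norm_num
  obtain ⟨K, hK⟩ := eventually_atTop.1 hdom
  have hcone : ∀ Q' ∈ 𝒬 (K + 1) \ 𝒬 K, ∃ M ∈ matCone (𝒬 K), (M - Q').PosSemidef := by
    intro Q' hQ'
    obtain ⟨i, rfl⟩ := hnew K Q' hQ'
    exact ⟨_, smul_mem_matCone (hQ0 K) (by norm_num), hK (K + 1) (Nat.le_succ K) i⟩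
  have hlift : ∀ x : Fin n → ℝ,
      Abar *ᵥ Sum.elim x (fun _ => 1) = Sum.elim (A *ᵥ x) fun _ => 1 := fun x => by
    rw [hAbar, fromBlocks_mulVec]
    ext (a | a) <;> simp [Function.comp_def]
  have hform : ∀ i (x : Fin n → ℝ), (Sum.elim x fun _ => 1) ⬝ᵥ Qbar i *ᵥ (Sum.elim x fun _ => 1)
      = x ⬝ᵥ Q i *ᵥ x + 2 * (q i ⬝ᵥ x) - 1 := fun i x => by
    have h1 : (of fun r (_ : Unit) => q i r) *ᵥ (fun _ : Unit => (1 : ℝ)) = q i := by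
      ext; simp [mulVec, dotProduct]
    have h2 : (of fun (_ : Unit) c => q i c) *ᵥ x = fun _ => q i ⬝ᵥ x := by
      ext; simp [mulVec]
    rw [hQbar, fromBlocks_mulVec, sumElim_dotProduct_sumElim]
    simp only [Sum.elim_comp_inl, Sum.elim_comp_inr, h1, h2, dotProduct_add, dotProduct_comm x (q i)]
    simp [dotProduct, mulVec]
    ring
  have hO : ∀ k x, x ∈ O k ↔
      ∀ M ∈ 𝒬 k, (Sum.elim x fun _ => (1 : ℝ)) ⬝ᵥ M *ᵥ (Sum.elim x fun _ => 1) ≤ 0 := by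
    intro k
    induction k with
    | zero =>
      intro x
      simp [hO0, hX, hΩ, h𝒬0, hform]
    | succ k ih =>
      intro x
      rw [hOsucc, Set.mem_inter_iff, Set.mem_ofPred_eq, ih, ih, h𝒬succ]
      simp only [Set.mem_union, or_imp, forall_and, Set.forall_mem_image,
        dotProduct_transpose_mul_mul_mulVec, hlift]
  have hstep : O (K + 1) = O K := by
    refine Set.Subset.antisymm (by rw [hOsucc]; exact Set.inter_subset_left) fun x hx => ?_
    rw [hO] at hx ⊢
    intro Q' hQ'
    by_cases h : Q' ∈ 𝒬 K
    · exact hx Q' h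
    obtain ⟨M, hM, hMQ⟩ := hcone Q' ⟨hQ', h⟩
    have h1 := dotProduct_mulVec_nonpos_of_mem_matCone hx hM
    have h2 := hMQ.dotProduct_mulVec_nonneg (Sum.elim x fun _ => 1)
    rw [star_trivial, sub_mulVec, dotProduct_sub] at h2
    linarith
  have hstable : ∀ k, K ≤ k → O k = O K := fun k hk => by
    induction k, hk using Nat.le_induction with
    | base => rfl
    | succ k _ ih => rw [hOsucc, ih, ← hOsucc, hstep]
  have hanti : Antitone O := antitone_nat_of_succ_le fun k => by
    rw [hOsucc]; exact Set.inter_subset_left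
  refine ⟨K, hcone, hstable, Set.Subset.antisymm (Set.iInter_subset O K) ?_⟩
  refine Set.subset_iInter fun k => ?_
  rcases le_total K k with h | h
  · exact (hstable k h).ge
  · exact hanti h
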